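/- Let u : [0,∞) → ℂ^{p×p} be continuous with u(x)* = u(x), and let ϑ : [0,∞) → ℂ^{p×2p} be twice differentiable with ϑ″(x) = u(x)ϑ(x) and with initial value B(0) = Θ₁ := (1/√2)[[i I_p, I_p],[i I_p, −I_p]], where B(x) = [ϑ(x); ϑ′(x)] ∈ ℂ^{2p×2p}. Then: (i) B(x)* J₁ B(x) = J for all x ≥ 0, where J₁ = i[[0, −I_p],[I_p, 0]] and J = [[0, I_p],[I_p, 0]]; consequently ϑ(x) J ϑ(x)* = 0 and ϑ′(x) J ϑ(x)* = i I_p for all x; (ii) for any λ ∈ ℂ, if 𝒲(·,λ) solves 𝒲′(x,λ) = iλ J ϑ(x)*ϑ(x) 𝒲(x,λ), then 𝒵(x,λ) = ϑ(x)𝒲(x,λ) satisfies the matrix Schrödinger equation −𝒵″(x,λ) + u(x)𝒵(x,λ) = λ 𝒵(x,λ) for all x ≥ 0. -/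

import Mathlib

open Matrix

/-- Product rule for matrix products, entrywise. -/
theorem hasDerivAt_matrix_mul_apply {l m n : Type*} [Fintype m]
    {M M' : ℝ → Matrix l m ℂ} {N N' : ℝ → Matrix m n ℂ} {x : ℝ}
    (hM : ∀ i j, HasDerivAt (fun t => M t i j) (M' x i j) x)
    (hN : ∀ i j, HasDerivAt (fun t => N t i j) (N' x i j) x) (i : l) (k : n) :
    HasDerivAt (fun t => (M t * N t) i k) ((M' x * N x + M x * N' x) i k) x := by
  simp only [Matrix.add_apply, Matrix.mul_apply, ← Finset.sum_add_distrib]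
  exact HasDerivAt.fun_sum fun j _ => (hM i j).mul (hN j k)

/-- A function with vanishing derivative on `[0, ∞)` is constant there. -/
theorem eq_apply_zero_of_hasDerivAt_zero {f : ℝ → ℂ}
    (hf : ∀ x : ℝ, 0 ≤ x → HasDerivAt f 0 x) {x : ℝ} (hx : 0 ≤ x) : f x = f 0 :=
  constant_of_has_deriv_right_zero
    (fun y hy => (hf y hy.1).continuousAt.continuousWithinAt)
    (fun y hy => (hf y hy.1).hasDerivWithinAt) x ⟨hx, le_rfl⟩

/-- The Wronskian `ϑ'ᴴ ϑ - ϑᴴ ϑ'` of a solution of `ϑ'' = u ϑ`, with `u` Hermitian, is constant. -/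
theorem wronskian_eq_apply_zero {m n : Type*} [Fintype m]
    {u : ℝ → Matrix m m ℂ} (husa : ∀ x : ℝ, 0 ≤ x → (u x)ᴴ = u x)
    {ϑ ϑ' ϑ'' : ℝ → Matrix m n ℂ}
    (hϑ' : ∀ x : ℝ, 0 ≤ x → ∀ i k, HasDerivAt (fun t => ϑ t i k) (ϑ' x i k) x)
    (hϑ'' : ∀ x : ℝ, 0 ≤ x → ∀ i k, HasDerivAt (fun t => ϑ' t i k) (ϑ'' x i k) x)
    (hSchrod : ∀ x : ℝ, 0 ≤ x → ϑ'' x = u x * ϑ x) {x : ℝ} (hx : 0 ≤ x) :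
    (ϑ' x)ᴴ * ϑ x - (ϑ x)ᴴ * ϑ' x = (ϑ' 0)ᴴ * ϑ 0 - (ϑ 0)ᴴ * ϑ' 0 := by
  ext i k
  refine eq_apply_zero_of_hasDerivAt_zero
    (f := fun t => ((ϑ' t)ᴴ * ϑ t - (ϑ t)ᴴ * ϑ' t) i k) (fun y hy => ?_) hx
  have h₁ := hasDerivAt_matrix_mul_apply (M := fun t => (ϑ' t)ᴴ) (M' := fun t => (ϑ'' t)ᴴ)
    (fun a b => (hϑ'' y hy b a).star) (hϑ' y hy) i k
  have h₂ := hasDerivAt_matrix_mul_apply (M := fun t => (ϑ t)ᴴ) (M' := fun t => (ϑ' t)ᴴ)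
    (fun a b => (hϑ' y hy b a).star) (hϑ'' y hy) i k
  refine (h₁.sub h₂).congr_deriv ?_
  rw [← Matrix.sub_apply, hSchrod y hy, Matrix.conjTranspose_mul, husa y hy, Matrix.mul_assoc]
  simp [add_comm]

/-- If `ϑ″ = uϑ` with `u` Hermitian and `B(0) = Θ₁ = (1/√2)[[iI, I],[iI, −I]]`
where `B = [ϑ; ϑ′]`, then (i) `B(x)* J₁ B(x) = J` for all `x ≥ 0`, hence `ϑ J ϑ* = 0` and
`ϑ′ J ϑ* = i I`; (ii) for any `λ`, if `𝒲′ = iλ J ϑ*ϑ 𝒲` then `𝒵 = ϑ𝒲` satisfies the matrix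
Schrödinger equation `−𝒵″ + u𝒵 = λ𝒵` on `[0,∞)`. -/
theorem schrodinger_from_canonical_system
    {p : ℕ} (hp : 0 < p)
    (J J₁ : Matrix (Fin p ⊕ Fin p) (Fin p ⊕ Fin p) ℂ)
    (hJ : J = Matrix.fromBlocks 0 1 1 0)
    (hJ₁ : J₁ = Complex.I • Matrix.fromBlocks 0 (-1) 1 0)
    (u : ℝ → Matrix (Fin p) (Fin p) ℂ)
    (hucont : Continuous u)
    (husa : ∀ x : ℝ, 0 ≤ x → (u x)ᴴ = u x)
    (ϑ ϑ' ϑ'' : ℝ → Matrix (Fin p) (Fin p ⊕ Fin p) ℂ)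
    (hϑ' : ∀ x : ℝ, 0 ≤ x → ∀ i k, HasDerivAt (fun t => ϑ t i k) (ϑ' x i k) x)
    (hϑ'' : ∀ x : ℝ, 0 ≤ x → ∀ i k, HasDerivAt (fun t => ϑ' t i k) (ϑ'' x i k) x)
    (hSchrod : ∀ x : ℝ, 0 ≤ x → ϑ'' x = u x * ϑ x)
    (B : ℝ → Matrix (Fin p ⊕ Fin p) (Fin p ⊕ Fin p) ℂ)
    (hB : ∀ x : ℝ, B x = Matrix.fromRows (ϑ x) (ϑ' x))
    (hB0 : B 0 = ((Real.sqrt 2 : ℂ))⁻¹ •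
      Matrix.fromBlocks (Complex.I • 1) 1 (Complex.I • 1) (-1)) :
    (∀ x : ℝ, 0 ≤ x →
      (B x)ᴴ * J₁ * B x = J ∧
      ϑ x * J * (ϑ x)ᴴ = 0 ∧
      ϑ' x * J * (ϑ x)ᴴ = Complex.I • 1) ∧
    (∀ lam : ℂ, ∀ 𝒲 : ℝ → Matrix (Fin p ⊕ Fin p) (Fin p ⊕ Fin p) ℂ,
      (∀ x : ℝ, 0 ≤ x → ∀ i k, HasDerivAt (fun t => 𝒲 t i k)
        (((Complex.I * lam) • (J * (ϑ x)ᴴ * ϑ x * 𝒲 x)) i k) x) →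
      ∃ Z' : ℝ → Matrix (Fin p) (Fin p ⊕ Fin p) ℂ,
        (∀ x : ℝ, 0 ≤ x → ∀ i k,
          HasDerivAt (fun t => (ϑ t * 𝒲 t) i k) (Z' x i k) x) ∧
        (∀ x : ℝ, 0 ≤ x → ∀ i k, HasDerivAt (fun t => Z' t i k)
          ((u x * (ϑ x * 𝒲 x) - lam • (ϑ x * 𝒲 x)) i k) x)) := by
  have hJJ : J * J = 1 := by
    simp [hJ, Matrix.fromBlocks_multiply]
  have hJ₁J₁ : J₁ * J₁ = 1 := by
    simp [hJ₁, Matrix.fromBlocks_multiply, smul_smul, Matrix.fromBlocks_smul]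
  have hform : ∀ x, (B x)ᴴ * J₁ * B x =
      Complex.I • ((ϑ' x)ᴴ * ϑ x - (ϑ x)ᴴ * ϑ' x) := by
    intro x
    rw [hB, hJ₁, Matrix.conjTranspose_fromRows_eq_fromCols_conjTranspose, Matrix.mul_smul,
      Matrix.smul_mul, Matrix.fromCols_mul_fromBlocks, Matrix.fromCols_mul_fromRows]
    simp [sub_eq_add_neg]
  have hinit : (B 0)ᴴ * J₁ * B 0 = J := by
    have hsq : ((Real.sqrt 2 : ℂ))⁻¹ * ((Real.sqrt 2 : ℂ))⁻¹ = 2⁻¹ := by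
      rw [← mul_inv, ← Complex.ofReal_mul, Real.mul_self_sqrt (by norm_num)]
      norm_num
    rw [hB0, hJ₁, hJ]
    simp only [Matrix.conjTranspose_smul, Matrix.fromBlocks_conjTranspose, Matrix.smul_mul,
      Matrix.mul_smul, smul_smul, Matrix.fromBlocks_multiply, Matrix.fromBlocks_smul]
    have e₁ : ((Real.sqrt 2 : ℂ))⁻¹ * (Complex.I * (((Real.sqrt 2 : ℂ))⁻¹ * Complex.I)) = -2⁻¹ := by
      linear_combination (-1 : ℂ) * hsq + ((Real.sqrt 2 : ℂ))⁻¹ ^ 2 * Complex.I_mul_I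
    have e₂ : ((Real.sqrt 2 : ℂ))⁻¹ * Complex.I * (Complex.I * ((Real.sqrt 2 : ℂ))⁻¹) = -2⁻¹ := by
      linear_combination e₁
    simp [smul_smul, e₁, e₂]
    module
  have hcons : ∀ x : ℝ, 0 ≤ x → (B x)ᴴ * J₁ * B x = J := fun x hx => by
    rw [hform, wronskian_eq_apply_zero husa hϑ' hϑ'' hSchrod hx, ← hform, hinit]
  have hdual : ∀ x : ℝ, 0 ≤ x → B x * J * (B x)ᴴ = J₁ := fun x hx => by
    have h : (J * (B x)ᴴ * J₁) * B x = 1 := by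
      rw [← hJJ, ← hcons x hx]
      simp only [Matrix.mul_assoc]
    have h' := mul_eq_one_comm.mp h
    calc B x * J * (B x)ᴴ = B x * (J * (B x)ᴴ * J₁) * J₁ := by
          simp only [Matrix.mul_assoc, hJ₁J₁, Matrix.mul_one]
      _ = J₁ := by rw [h', Matrix.one_mul]
  have hblocks : ∀ x : ℝ, 0 ≤ x →
      ϑ x * J * (ϑ x)ᴴ = 0 ∧ ϑ' x * J * (ϑ x)ᴴ = Complex.I • 1 := fun x hx => by
    have h := hdual x hx
    rw [hB, hJ₁, Matrix.conjTranspose_fromRows_eq_fromCols_conjTranspose, Matrix.fromRows_mul,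
      Matrix.fromRows_mul_fromCols, Matrix.fromBlocks_smul, Matrix.fromBlocks_inj] at h
    exact ⟨by simpa using h.1, h.2.2.1⟩
  refine ⟨fun x hx => ⟨hcons x hx, hblocks x hx⟩, fun lam 𝒲 h𝒲 => ?_⟩
  have key : ∀ (x : ℝ) (A : Matrix (Fin p) (Fin p ⊕ Fin p) ℂ),
      A * ((Complex.I * lam) • (J * (ϑ x)ᴴ * ϑ x * 𝒲 x)) =
        (Complex.I * lam) • (A * J * (ϑ x)ᴴ * (ϑ x * 𝒲 x)) := fun x A => by
    simp only [Matrix.mul_smul, Matrix.mul_assoc]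
  refine ⟨fun t => ϑ' t * 𝒲 t, fun x hx i k => ?_, fun x hx i k => ?_⟩
  · convert hasDerivAt_matrix_mul_apply (hϑ' x hx)
      (N' := fun x => (Complex.I * lam) • (J * (ϑ x)ᴴ * ϑ x * 𝒲 x)) (h𝒲 x hx) i k using 2
    rw [key, (hblocks x hx).1]
    simp
  · convert hasDerivAt_matrix_mul_apply (hϑ'' x hx)
      (N' := fun x => (Complex.I * lam) • (J * (ϑ x)ᴴ * ϑ x * 𝒲 x)) (h𝒲 x hx) i k using 2
    rw [key, (hblocks x hx).2, hSchrod x hx, Matrix.smul_mul, Matrix.one_mul, smul_smul,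
      mul_right_comm, Complex.I_mul_I, neg_one_mul, neg_smul, Matrix.mul_assoc, sub_eq_add_neg]
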